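/- arXiv:2601.15107 — 2 statements merged into one kernel-verified Lean document; each statement's English description precedes it below -/
import Mathlib

section
/- Fix c ∈ ℝ. (i) Let y₁, y₂ : [0, s_*] → ℝ be continuous, with y₁(t) > 0 and y₂(t) > 0 for all t ∈ (0, s_*), and suppose that for all 0 ≤ r ≤ t ≤ s_* one has y₁(t) − y₁(r) ≤ ∫_r^t p'[(c − h(s)) y₁(s)^{1/p} − f(s)] ds and y₂(t) − y₂(r) ≥ ∫_r^t p'[(c − h(s)) y₂(s)^{1/p} − f(s)] ds. If y₁(0) ≤ y₂(0), then y₁(t) ≤ y₂(t) for all t ∈ [0, s_*]. (ii) Let y₁, y₂ : [s_*, 1] → ℝ be continuous, with y₁(t) > 0 and y₂(t) > 0 for all t ∈ (s_*, 1), satisfying the same integral sub-solution inequality for y₁ and super-solution inequality for y₂ for all s_* ≤ r ≤ t ≤ 1. If y₁(1) ≥ y₂(1), then y₁(t) ≥ y₂(t) for all t ∈ [s_*, 1]. -/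
open MeasureTheory Set Filter Topology intervalIntegral

noncomputable section

/-- A Carathéodory solution on `[a,b]` of the ODE
`y'(t) = p' * ((c - h t) * (y⁺ t)^(1/p) - f t)`, in integral form. -/
def IsCaraSol (p p' : ℝ) (h f : ℝ → ℝ) (c a b : ℝ) (y : ℝ → ℝ) : Prop :=
  ContinuousOn y (Set.Icc a b) ∧
  ∀ t ∈ Set.Icc a b,
    y t = y a + ∫ u in a..t, p' * ((c - h u) * (max (y u) 0) ^ (1 / p) - f u)

/-- A positive solution of the boundary value problem on `[a,b]`. -/
def IsPosBVPSol (p p' : ℝ) (h f : ℝ → ℝ) (c a b : ℝ) (y : ℝ → ℝ) : Prop :=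
  IsCaraSol p p' h f c a b y ∧ y a = 0 ∧ y b = 0 ∧ ∀ t ∈ Set.Ioo a b, 0 < y t

/-- Tangent line inequality for the concave function `x ↦ x ^ (1 - q)`. -/
theorem rpow_one_sub_sub_le {q x y : ℝ} (hq0 : 0 ≤ q) (hq1 : q ≤ 1) (hx : 0 < x) (hy : 0 < y) :
    x ^ (1 - q) - y ^ (1 - q) ≤ (1 - q) * y ^ (-q) * (x - y) := by
  have hyq : 0 < y ^ (-q) := Real.rpow_pos_of_pos hy _
  have hamgm := Real.geom_mean_le_arith_mean2_weighted (sub_nonneg.2 hq1) hq0 hx.le hy.le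
    (by ring)
  have hone : y ^ q * y ^ (-q) = 1 := by rw [← Real.rpow_add hy]; simp
  have hsplit : y ^ (1 - q) = y * y ^ (-q) := by
    rw [sub_eq_add_neg, Real.rpow_add hy, Real.rpow_one]
  have hmul := mul_le_mul_of_nonneg_right hamgm hyq.le
  rw [mul_assoc, hone, mul_one] at hmul
  rw [hsplit]
  linarith

/-- A continuous function whose increments are controlled from above by Riemann-type sums of
`A * g₁ - B * g₂ ≤ 0` does not increase. -/
theorem le_of_increment_le {D A B g₁ g₂ : ℝ → ℝ} {a b : ℝ} (hab : a ≤ b)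
    (hDc : ContinuousOn D (Icc a b)) (hA : ContinuousOn A (Icc a b))
    (hB : ContinuousOn B (Icc a b))
    (hg₁ : IntervalIntegrable g₁ volume a b) (hg₂ : IntervalIntegrable g₂ volume a b)
    (hD : ∀ x t, a ≤ x → x ≤ t → t ≤ b →
      D t - D x ≤ A x * (∫ u in x..t, g₁ u) - B t * ∫ u in x..t, g₂ u)
    (hle : ∀ u ∈ Icc a b, A u * g₁ u ≤ B u * g₂ u) :
    D b ≤ D a := by
  set G : ℝ → ℝ := fun u => |g₁ u| + |g₂ u| with hG
  have hGi : IntervalIntegrable G volume a b := hg₁.abs.add hg₂.abs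
  have hsub : ∀ x t, a ≤ x → x ≤ t → t ≤ b → uIcc x t ⊆ uIcc a b := by
    intro x t hax hxt htb
    rw [uIcc_of_le hxt, uIcc_of_le hab]
    exact Icc_subset_Icc hax htb
  have key : ∀ ε > 0, D b ≤ D a + ε * ∫ u in a..b, G u := by
    intro ε hε
    have hprim : ContinuousOn (fun t => ∫ u in a..t, G u) (Icc a b) := by
      have := continuousOn_primitive_interval' hGi left_mem_uIcc
      rwa [uIcc_of_le hab] at this
    have hclosed : IsClosed ({t | D t ≤ D a + ε * ∫ u in a..t, G u} ∩ Icc a b) := by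
      have hrhs : ContinuousOn (fun t => D a + ε * ∫ u in a..t, G u) (Icc a b) :=
        continuousOn_const.add (continuousOn_const.mul hprim)
      have := isClosed_Icc.isClosed_le hDc hrhs
      convert this using 1
      ext t
      simp [and_comm]
    refine hclosed.Icc_subset_of_forall_exists_gt (by simp) ?_ (right_mem_Icc.2 hab)
    rintro x ⟨hx, hxa, hxb⟩ z hz
    have hxI : x ∈ Icc a b := ⟨hxa, hxb.le⟩
    obtain ⟨δ₁, hδ₁, h₁⟩ := Metric.continuousWithinAt_iff.1 (hA x hxI) ε hε
    obtain ⟨δ₂, hδ₂, h₂⟩ := Metric.continuousWithinAt_iff.1 (hB x hxI) (ε / 2) (half_pos hε)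
    obtain ⟨t, hxt, ht⟩ : ∃ t, x < t ∧ t < min (min (x + δ₁) (x + δ₂)) (min b z) :=
      exists_between (by simp [hδ₁, hδ₂, hxb, mem_Ioi.1 hz])
    simp only [lt_min_iff] at ht
    obtain ⟨⟨ht₁, ht₂⟩, htb, htz⟩ := ht
    refine ⟨t, ?_, hxt, htz.le⟩
    have i₁ := hg₁.mono_set (hsub x t hxa hxt.le htb.le)
    have i₂ := hg₂.mono_set (hsub x t hxa hxt.le htb.le)
    have iG := hGi.mono_set (hsub x t hxa hxt.le htb.le)
    have hint : A x * (∫ u in x..t, g₁ u) - B t * (∫ u in x..t, g₂ u)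
        ≤ ε * ∫ u in x..t, G u := by
      rw [← intervalIntegral.integral_const_mul, ← intervalIntegral.integral_const_mul,
        ← intervalIntegral.integral_const_mul,
        ← intervalIntegral.integral_sub (i₁.const_mul _) (i₂.const_mul _)]
      refine intervalIntegral.integral_mono_on hxt.le
        ((i₁.const_mul _).sub (i₂.const_mul _)) (iG.const_mul _) ?_
      intro u hu
      have huI : u ∈ Icc a b := ⟨hxa.trans hu.1, hu.2.trans htb.le⟩
      have d₁ := h₁ huI (by rw [Real.dist_eq, abs_lt]; constructor <;> linarith [hu.1, hu.2])
      have d₂ := h₂ huI (by rw [Real.dist_eq, abs_lt]; constructor <;> linarith [hu.1, hu.2])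
      have d₃ := h₂ (x := t) ⟨hxa.trans hxt.le, htb.le⟩
        (by rw [Real.dist_eq, abs_lt]; constructor <;> linarith)
      have e₁ : |A x - A u| ≤ ε := by
        rw [abs_sub_comm]; exact d₁.le
      have e₂ : |B u - B t| ≤ ε := by
        rw [← Real.dist_eq]
        linarith [dist_triangle_right (B u) (B t) (B x)]
      have m₁ : (A x - A u) * g₁ u ≤ ε * |g₁ u| := (le_abs_self _).trans
        (by rw [abs_mul]; gcongr)
      have m₂ : (B u - B t) * g₂ u ≤ ε * |g₂ u| := (le_abs_self _).trans
        (by rw [abs_mul]; gcongr)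
      have := hle u huI
      simp only [hG]
      linarith
    have hadd : (∫ u in a..t, G u) = (∫ u in a..x, G u) + ∫ u in x..t, G u :=
      (intervalIntegral.integral_add_adjacent_intervals
        (hGi.mono_set (hsub a x le_rfl hxa hxb.le)) iG).symm
    simp only [mem_ofPred_eq] at hx ⊢
    rw [hadd]
    linarith [hD x t hxa hxt.le htb.le]
  have hlim : Tendsto (fun ε : ℝ => D a + ε * ∫ u in a..b, G u) (𝓝[>] 0) (𝓝 (D a)) := by
    have : Tendsto (fun ε : ℝ => D a + ε * ∫ u in a..b, G u) (𝓝 0)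
        (𝓝 (D a + 0 * ∫ u in a..b, G u)) := by
      apply Continuous.tendsto
      fun_prop
    rw [zero_mul, add_zero] at this
    exact this.mono_left nhdsWithin_le_nhds
  exact ge_of_tendsto hlim (eventually_mem_nhdsWithin.mono fun ε hε => key ε hε)

/-- The bounded coefficient times a continuous function minus an integrable one is integrable. -/
theorem intervalIntegrable_rhs {p p' c a b : ℝ} {h f y : ℝ → ℝ} (hab : a ≤ b) (hp : 1 < p)
    (hmeas : Measurable h) (hbd : ∃ M : ℝ, ∀ t ∈ Icc a b, |h t| ≤ M)
    (hf : IntervalIntegrable f volume a b) (hy : ContinuousOn y (Icc a b)) :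
    IntervalIntegrable (fun u => p' * ((c - h u) * (y u) ^ (1 / p) - f u)) volume a b := by
  obtain ⟨M, hM⟩ := hbd
  have hh : IntervalIntegrable h volume a b := by
    rw [intervalIntegrable_iff_integrableOn_Icc_of_le hab]
    refine Measure.integrableOn_of_bounded (M := M) (by simp) hmeas.aestronglyMeasurable ?_
    exact (ae_restrict_iff' measurableSet_Icc).2 (Eventually.of_forall hM)
  have hyc : ContinuousOn (fun u => (y u) ^ (1 / p)) (uIcc a b) := by
    rw [uIcc_of_le hab]
    exact hy.rpow_const fun _ _ => Or.inr (by positivity)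
  exact (((intervalIntegrable_const.sub hh).mul_continuousOn hyc).sub hf).const_mul _

/-- On an interval where `f * (y₁ ^ (-1/p) - y₂ ^ (-1/p))` is nonnegative, the difference of
`y₁ ^ (1 - 1/p)` and `y₂ ^ (1 - 1/p)` does not increase, for a sub-solution `y₁` and a
super-solution `y₂`. -/
theorem rpow_sub_rpow_le_of_sub_super {p p' c a b : ℝ} {h f y₁ y₂ : ℝ → ℝ} (hab : a ≤ b)
    (hp : 1 < p) (hp' : 0 < p')
    (hmeas : Measurable h) (hbd : ∃ M : ℝ, ∀ t ∈ Icc a b, |h t| ≤ M)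
    (hf : IntervalIntegrable f volume a b)
    (hy₁ : ContinuousOn y₁ (Icc a b)) (hy₂ : ContinuousOn y₂ (Icc a b))
    (hpos₁ : ∀ t ∈ Ioo a b, 0 < y₁ t) (hpos₂ : ∀ t ∈ Ioo a b, 0 < y₂ t)
    (hsub : ∀ r t : ℝ, a ≤ r → r ≤ t → t ≤ b →
      y₁ t - y₁ r ≤ ∫ u in r..t, p' * ((c - h u) * (y₁ u) ^ (1 / p) - f u))
    (hsup : ∀ r t : ℝ, a ≤ r → r ≤ t → t ≤ b →
      (∫ u in r..t, p' * ((c - h u) * (y₂ u) ^ (1 / p) - f u)) ≤ y₂ t - y₂ r)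
    (hsign : ∀ t ∈ Ioo a b, 0 ≤ f t * (y₁ t ^ (-(1 / p)) - y₂ t ^ (-(1 / p)))) :
    y₁ b ^ (1 - 1 / p) - y₂ b ^ (1 - 1 / p) ≤ y₁ a ^ (1 - 1 / p) - y₂ a ^ (1 - 1 / p) := by
  have hq0 : 0 < 1 / p := by positivity
  have hq1 : 1 / p < 1 := by rw [div_lt_one (by linarith)]; exact hp
  have hDc : ContinuousOn (fun t => y₁ t ^ (1 - 1 / p) - y₂ t ^ (1 - 1 / p)) (Icc a b) :=
    (hy₁.rpow_const fun _ _ => Or.inr (by linarith)).sub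
      (hy₂.rpow_const fun _ _ => Or.inr (by linarith))
  have hmono : ∀ r t, a < r → r ≤ t → t < b →
      y₁ t ^ (1 - 1 / p) - y₂ t ^ (1 - 1 / p) ≤ y₁ r ^ (1 - 1 / p) - y₂ r ^ (1 - 1 / p) := by
    intro r t har hrt htb
    have hI : Icc r t ⊆ Ioo a b := fun u hu => ⟨har.trans_le hu.1, hu.2.trans_lt htb⟩
    have hI' : Icc r t ⊆ Icc a b := hI.trans Ioo_subset_Icc_self
    have hu : uIcc r t ⊆ uIcc a b := by rwa [uIcc_of_le hrt, uIcc_of_le hab]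
    have hw : ∀ y : ℝ → ℝ, ContinuousOn y (Icc a b) → (∀ t ∈ Ioo a b, 0 < y t) →
        ContinuousOn (fun u => (1 - 1 / p) * y u ^ (-(1 / p))) (Icc r t) := fun y hy hpos =>
      continuousOn_const.mul ((hy.mono hI').rpow_const fun u hu => Or.inl (hpos u (hI hu)).ne')
    refine le_of_increment_le hrt (hDc.mono hI') (hw y₁ hy₁ hpos₁) (hw y₂ hy₂ hpos₂)
      ((intervalIntegrable_rhs (p' := p') (c := c) hab hp hmeas hbd hf hy₁).mono_set hu)
      ((intervalIntegrable_rhs (p' := p') (c := c) hab hp hmeas hbd hf hy₂).mono_set hu) ?_ ?_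
    · intro x z hrx hxz hzt
      have hx := hI ⟨hrx, hxz.trans hzt⟩
      have hz := hI ⟨hrx.trans hxz, hzt⟩
      have c₁ := rpow_one_sub_sub_le hq0.le hq1.le (hpos₁ z hz) (hpos₁ x hx)
      have c₂ := rpow_one_sub_sub_le hq0.le hq1.le (hpos₂ x hx) (hpos₂ z hz)
      have k₁ : 0 ≤ (1 - 1 / p) * y₁ x ^ (-(1 / p)) :=
        mul_nonneg (by linarith) (Real.rpow_nonneg (hpos₁ x hx).le _)
      have k₂ : 0 ≤ (1 - 1 / p) * y₂ z ^ (-(1 / p)) :=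
        mul_nonneg (by linarith) (Real.rpow_nonneg (hpos₂ z hz).le _)
      have l₁ := mul_le_mul_of_nonneg_left (hsub x z hx.1.le hxz hz.2.le) k₁
      have l₂ := mul_le_mul_of_nonneg_left (hsup x z hx.1.le hxz hz.2.le) k₂
      linarith
    · intro u hu
      have hone : ∀ y : ℝ, 0 < y → y ^ (-(1 / p)) * y ^ (1 / p) = 1 := fun y hy => by
        rw [← Real.rpow_add hy]; simp
      have o₁ := hone _ (hpos₁ u (hI hu))
      have o₂ := hone _ (hpos₂ u (hI hu))
      have hs := mul_nonneg (mul_nonneg (sub_nonneg.2 hq1.le) hp'.le) (hsign u (hI hu))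
      linear_combination hs + (1 - 1 / p) * p' * (c - h u) * (o₁ - o₂)
  rcases hab.eq_or_lt with rfl | hlt
  · exact le_rfl
  obtain ⟨m, ham, hmb⟩ := exists_between hlt
  have hleft : Icc a m ⊆ Icc a b := Icc_subset_Icc le_rfl hmb.le
  have hright : Icc m b ⊆ Icc a b := Icc_subset_Icc ham.le le_rfl
  rw [← closure_Ioo ham.ne] at hleft
  rw [← closure_Ioo hmb.ne] at hright
  exact (le_on_closure (fun t ht => hmono m t ham ht.1.le ht.2) (hDc.mono hright)
      continuousOn_const (by rw [closure_Ioo hmb.ne]; exact right_mem_Icc.2 hmb.le)).trans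
    (le_on_closure (fun t ht => hmono t m ht.1 ht.2.le hmb) continuousOn_const
      (hDc.mono hleft) (by rw [closure_Ioo ham.ne]; exact left_mem_Icc.2 ham.le))

theorem stmt_5
    (p p' s : ℝ) (h f : ℝ → ℝ)
    (hp : 1 < p) (hp'def : p' = p / (p - 1))
    (hs : s ∈ Set.Ioo (0:ℝ) 1)
    (hmeas : Measurable h)
    (hbd : ∃ M : ℝ, ∀ t ∈ Set.Icc (0:ℝ) 1, |h t| ≤ M)
    (hfint : MeasureTheory.IntegrableOn f (Set.Ioo (0:ℝ) 1))
    (hf0 : f 0 = 0) (hfs : f s = 0) (hf1 : f 1 = 0)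
    (hfneg : ∀ t ∈ Set.Ioo (0:ℝ) s, f t < 0)
    (hfpos : ∀ t ∈ Set.Ioo s (1:ℝ), 0 < f t)
    (husc : UpperSemicontinuousOn f (Set.Ioo (0:ℝ) s))
    (hlsc : LowerSemicontinuousOn f (Set.Ioo s (1:ℝ)))
    (c : ℝ) :
    (∀ y₁ y₂ : ℝ → ℝ,
      ContinuousOn y₁ (Set.Icc 0 s) → ContinuousOn y₂ (Set.Icc 0 s) →
      (∀ t ∈ Set.Ioo (0:ℝ) s, 0 < y₁ t) → (∀ t ∈ Set.Ioo (0:ℝ) s, 0 < y₂ t) →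
      (∀ r t : ℝ, 0 ≤ r → r ≤ t → t ≤ s →
        y₁ t - y₁ r ≤ ∫ u in r..t, p' * ((c - h u) * (y₁ u) ^ (1 / p) - f u)) →
      (∀ r t : ℝ, 0 ≤ r → r ≤ t → t ≤ s →
        (∫ u in r..t, p' * ((c - h u) * (y₂ u) ^ (1 / p) - f u)) ≤ y₂ t - y₂ r) →
      y₁ 0 ≤ y₂ 0 → ∀ t ∈ Set.Icc (0:ℝ) s, y₁ t ≤ y₂ t) ∧
    (∀ y₁ y₂ : ℝ → ℝ,
      ContinuousOn y₁ (Set.Icc s 1) → ContinuousOn y₂ (Set.Icc s 1) →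
      (∀ t ∈ Set.Ioo s (1:ℝ), 0 < y₁ t) → (∀ t ∈ Set.Ioo s (1:ℝ), 0 < y₂ t) →
      (∀ r t : ℝ, s ≤ r → r ≤ t → t ≤ 1 →
        y₁ t - y₁ r ≤ ∫ u in r..t, p' * ((c - h u) * (y₁ u) ^ (1 / p) - f u)) →
      (∀ r t : ℝ, s ≤ r → r ≤ t → t ≤ 1 →
        (∫ u in r..t, p' * ((c - h u) * (y₂ u) ^ (1 / p) - f u)) ≤ y₂ t - y₂ r) →
      y₂ 1 ≤ y₁ 1 → ∀ t ∈ Set.Icc s (1:ℝ), y₂ t ≤ y₁ t) := by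
  obtain ⟨hs0, hs1⟩ := hs
  have hp' : 0 < p' := by rw [hp'def]; exact div_pos (by linarith) (by linarith)
  have hq0 : 0 < 1 / p := by positivity
  have hq1 : 0 < 1 - 1 / p := by
    rw [sub_pos, div_lt_one (by linarith)]; exact hp
  obtain ⟨M, hM⟩ := hbd
  have hbd' : ∀ a b, 0 ≤ a → b ≤ 1 → ∃ M : ℝ, ∀ t ∈ Icc a b, |h t| ≤ M :=
    fun a b ha hb => ⟨M, fun t ht => hM t ⟨ha.trans ht.1, ht.2.trans hb⟩⟩
  have hfi : ∀ a b, 0 ≤ a → a ≤ b → b ≤ 1 → IntervalIntegrable f volume a b := by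
    intro a b ha hab hb
    rw [intervalIntegrable_iff_integrableOn_Ioo_of_le hab]
    exact hfint.mono_set (Ioo_subset_Ioo ha hb)
  have hnonneg : ∀ (a b : ℝ) (y : ℝ → ℝ), a < b → ContinuousOn y (Icc a b) →
      (∀ t ∈ Ioo a b, 0 < y t) → ∀ t ∈ Icc a b, 0 ≤ y t := by
    intro a b y hab hy hpos t ht
    rw [← closure_Ioo hab.ne] at hy ht
    exact le_on_closure (fun u hu => (hpos u hu).le) continuousOn_const hy ht
  constructor
  · intro y₁ y₂ hy₁ hy₂ hpos₁ hpos₂ hsub hsup h0 t₁ ht₁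
    by_contra! hlt
    have hJ : Icc 0 t₁ ⊆ Icc 0 s := Icc_subset_Icc le_rfl ht₁.2
    have hcomp : IsCompact {t ∈ Icc 0 t₁ | y₁ t ≤ y₂ t} :=
      isCompact_Icc.of_isClosed_subset
        (isClosed_Icc.isClosed_le (hy₁.mono hJ) (hy₂.mono hJ)) (sep_subset _ _)
    obtain ⟨t₀, ⟨⟨ht₀0, ht₀₁⟩, hle⟩, hmax⟩ := hcomp.exists_isGreatest
      ⟨0, left_mem_Icc.2 ht₁.1, h0⟩
    have hI : Icc t₀ t₁ ⊆ Icc 0 s := Icc_subset_Icc ht₀0 ht₁.2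
    have hO : Ioo t₀ t₁ ⊆ Ioo 0 s := Ioo_subset_Ioo ht₀0 ht₁.2
    have hord : ∀ t ∈ Ioo t₀ t₁, y₂ t < y₁ t := by
      intro t ht
      by_contra! hc
      exact absurd (hmax ⟨⟨ht₀0.trans ht.1.le, ht.2.le⟩, hc⟩) (not_le.2 ht.1)
    have hD := rpow_sub_rpow_le_of_sub_super ht₀₁ hp hp' hmeas
      (hbd' t₀ t₁ ht₀0 (ht₁.2.trans hs1.le)) (hfi t₀ t₁ ht₀0 ht₀₁ (ht₁.2.trans hs1.le))
      (hy₁.mono hI) (hy₂.mono hI) (fun t ht => hpos₁ t (hO ht)) (fun t ht => hpos₂ t (hO ht))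
      (fun r t hr hrt ht => hsub r t (ht₀0.trans hr) hrt (ht.trans ht₁.2))
      (fun r t hr hrt ht => hsup r t (ht₀0.trans hr) hrt (ht.trans ht₁.2))
      (fun t ht => mul_nonneg_of_nonpos_of_nonpos (hfneg t (hO ht)).le (sub_nonpos.2
        (Real.rpow_le_rpow_of_nonpos (hpos₂ t (hO ht)) (hord t ht).le (by linarith))))
    have e₀ := Real.rpow_le_rpow (hnonneg 0 s y₁ hs0 hy₁ hpos₁ t₀ ⟨ht₀0, ht₀₁.trans ht₁.2⟩)
      hle hq1.le
    have e₁ := Real.rpow_lt_rpow (hnonneg 0 s y₂ hs0 hy₂ hpos₂ t₁ ht₁) hlt hq1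
    linarith
  · intro y₁ y₂ hy₁ hy₂ hpos₁ hpos₂ hsub hsup h1 t₁ ht₁
    by_contra! hlt
    have hJ : Icc t₁ 1 ⊆ Icc s 1 := Icc_subset_Icc ht₁.1 le_rfl
    have hcomp : IsCompact {t ∈ Icc t₁ 1 | y₂ t ≤ y₁ t} :=
      isCompact_Icc.of_isClosed_subset
        (isClosed_Icc.isClosed_le (hy₂.mono hJ) (hy₁.mono hJ)) (sep_subset _ _)
    obtain ⟨t₀, ⟨⟨ht₁₀, ht₀1⟩, hle⟩, hmin⟩ := hcomp.exists_isLeast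
      ⟨1, right_mem_Icc.2 ht₁.2, h1⟩
    have hI : Icc t₁ t₀ ⊆ Icc s 1 := Icc_subset_Icc ht₁.1 ht₀1
    have hO : Ioo t₁ t₀ ⊆ Ioo s 1 := Ioo_subset_Ioo ht₁.1 ht₀1
    have hord : ∀ t ∈ Ioo t₁ t₀, y₁ t < y₂ t := by
      intro t ht
      by_contra! hc
      exact absurd (hmin ⟨⟨ht.1.le, ht.2.le.trans ht₀1⟩, hc⟩) (not_le.2 ht.2)
    have hD := rpow_sub_rpow_le_of_sub_super ht₁₀ hp hp' hmeas
      (hbd' t₁ t₀ (hs0.le.trans ht₁.1) ht₀1) (hfi t₁ t₀ (hs0.le.trans ht₁.1) ht₁₀ ht₀1)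
      (hy₁.mono hI) (hy₂.mono hI) (fun t ht => hpos₁ t (hO ht)) (fun t ht => hpos₂ t (hO ht))
      (fun r t hr hrt ht => hsub r t (ht₁.1.trans hr) hrt (ht.trans ht₀1))
      (fun r t hr hrt ht => hsup r t (ht₁.1.trans hr) hrt (ht.trans ht₀1))
      (fun t ht => mul_nonneg (hfpos t (hO ht)).le (sub_nonneg.2
        (Real.rpow_le_rpow_of_nonpos (hpos₁ t (hO ht)) (hord t ht).le (by linarith))))
    have e₀ := Real.rpow_le_rpow (hnonneg s 1 y₂ hs1 hy₂ hpos₂ t₀ ⟨ht₁.1.trans ht₁₀, ht₀1⟩)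
      hle hq1.le
    have e₁ := Real.rpow_lt_rpow (hnonneg s 1 y₁ hs1 hy₁ hpos₁ t₁ ht₁) hlt hq1
    linarith
end
end

section
/- Let c₁ < c₂ be real numbers. If ỹ₁ and ỹ₂ are Carathéodory solutions on [0, s_*] of the ODE with parameters c₁ and c₂ respectively, with ỹ₁(0) = ỹ₂(0) = 0 and ỹ₁(t) > 0, ỹ₂(t) > 0 for all t ∈ (0, s_*), then ỹ₁(t) < ỹ₂(t) for all t ∈ (0, s_*). If ŷ₁ and ŷ₂ are Carathéodory solutions on [s_*, 1] of the ODE with parameters c₁ and c₂ respectively, with ŷ₁(1) = ŷ₂(1) = 0 and ŷ₁(t) > 0, ŷ₂(t) > 0 for all t ∈ (s_*, 1), then ŷ₁(t) > ŷ₂(t) for all t ∈ (s_*, 1). -/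
open MeasureTheory Set Filter Topology intervalIntegral

noncomputable section

/-- A Lipschitz function of an absolutely continuous function is absolutely continuous. -/
theorem LipschitzOnWith.comp_absolutelyContinuousOnInterval {φ y : ℝ → ℝ} {K : NNReal} {S : Set ℝ}
    {a b : ℝ} (hφ : LipschitzOnWith K φ S) (hy : AbsolutelyContinuousOnInterval y a b)
    (hS : MapsTo y (uIcc a b) S) : AbsolutelyContinuousOnInterval (fun t => φ (y t)) a b := by
  rw [absolutelyContinuousOnInterval_iff] at hy ⊢
  intro ε hε
  obtain ⟨δ, hδ, H⟩ := hy (ε / (K + 1)) (by positivity)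
  refine ⟨δ, hδ, fun E hE hlen => ?_⟩
  calc ∑ i ∈ Finset.range E.1, dist (φ (y (E.2 i).1)) (φ (y (E.2 i).2))
      ≤ ∑ i ∈ Finset.range E.1, K * dist (y (E.2 i).1) (y (E.2 i).2) :=
        Finset.sum_le_sum fun i hi =>
          hφ.dist_le_mul _ (hS (hE.1 i hi).1) _ (hS (hE.1 i hi).2)
    _ = K * ∑ i ∈ Finset.range E.1, dist (y (E.2 i).1) (y (E.2 i).2) := by rw [Finset.mul_sum]
    _ ≤ K * (ε / (K + 1)) := by gcongr; exact (H E hE hlen).le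
    _ < (K + 1) * (ε / (K + 1)) := by gcongr; linarith
    _ = ε := by field_simp

/-- An absolutely continuous function whose derivative is almost everywhere nonpositive
does not increase. -/
theorem AbsolutelyContinuousOnInterval.le_of_ae_deriv_nonpos {w : ℝ → ℝ} {a b : ℝ} (hab : a ≤ b)
    (hw : AbsolutelyContinuousOnInterval w a b) (hd : ∀ᵐ t, t ∈ Icc a b → deriv w t ≤ 0) :
    w b ≤ w a := by
  have hint := hw.integral_deriv_eq_sub
  have : 0 ≤ ∫ t in a..b, -deriv w t := by
    refine integral_nonneg_of_ae_restrict hab ?_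
    rw [EventuallyLE, ae_restrict_iff' measurableSet_Icc]
    filter_upwards [hd] with t ht hmem
    simpa using ht hmem
  rw [intervalIntegral.integral_neg] at this
  linarith

namespace IsCaraSol

variable {p p' a b c M : ℝ} {h f y : ℝ → ℝ}

theorem intervalIntegrable_growth (hp : 0 < p) (hab : a ≤ b) (hmeas : Measurable h)
    (hbd : ∀ t ∈ Icc a b, |h t| ≤ M) (hy : ContinuousOn y (Icc a b)) :
    IntervalIntegrable (fun u => (c - h u) * (max (y u) 0) ^ (1 / p)) volume a b := by
  refine IntervalIntegrable.mul_continuousOn (intervalIntegrable_const.sub ?_) ?_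
  · rw [intervalIntegrable_iff_integrableOn_Icc_of_le hab]
    refine Measure.integrableOn_of_bounded (M := M) (by simp) hmeas.aestronglyMeasurable ?_
    rw [ae_restrict_iff' measurableSet_Icc]
    exact Eventually.of_forall hbd
  · rw [uIcc_of_le hab]
    exact (hy.sup continuousOn_const).rpow_const fun _ _ => Or.inr (by positivity)

theorem intervalIntegrable_rhs (hp : 0 < p) (hab : a ≤ b) (hmeas : Measurable h)
    (hbd : ∀ t ∈ Icc a b, |h t| ≤ M) (hf : IntervalIntegrable f volume a b)
    (hy : IsCaraSol p p' h f c a b y) :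
    IntervalIntegrable (fun u => p' * ((c - h u) * (max (y u) 0) ^ (1 / p) - f u)) volume a b :=
  ((intervalIntegrable_growth hp hab hmeas hbd hy.1).sub hf).const_mul p'

theorem absolutelyContinuousOnInterval (hp : 0 < p) (hab : a ≤ b) (hmeas : Measurable h)
    (hbd : ∀ t ∈ Icc a b, |h t| ≤ M) (hf : IntervalIntegrable f volume a b)
    (hy : IsCaraSol p p' h f c a b y) : AbsolutelyContinuousOnInterval y a b := by
  have hI := IntervalIntegrable.absolutelyContinuousOnInterval_intervalIntegral (c := a)
    (intervalIntegrable_rhs hp hab hmeas hbd hf hy) left_mem_uIcc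
  rw [absolutelyContinuousOnInterval_iff] at hI ⊢
  intro ε hε
  obtain ⟨δ, hδ, H⟩ := hI ε hε
  refine ⟨δ, hδ, fun E hE hlen => (Finset.sum_congr rfl fun i hi => ?_).trans_lt (H E hE hlen)⟩
  have hmem := hE.1 i hi
  rw [uIcc_of_le hab] at hmem
  rw [hy.2 _ hmem.1, hy.2 _ hmem.2, dist_add_left]

theorem ae_hasDerivAt (hp : 0 < p) (hab : a ≤ b) (hmeas : Measurable h)
    (hbd : ∀ t ∈ Icc a b, |h t| ≤ M) (hf : IntervalIntegrable f volume a b)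
    (hy : IsCaraSol p p' h f c a b y) :
    ∀ᵐ t, t ∈ Ioo a b →
      HasDerivAt y (p' * ((c - h t) * (max (y t) 0) ^ (1 / p) - f t)) t := by
  filter_upwards [(intervalIntegrable_rhs hp hab hmeas hbd hf hy).ae_hasDerivAt_integral]
    with t ht hmem
  have hd := (ht (by rw [uIcc_of_le hab]; exact Ioo_subset_Icc_self hmem) a left_mem_uIcc).const_add
    (y a)
  refine hd.congr_of_eventuallyEq ?_
  filter_upwards [Ioo_mem_nhds hmem.1 hmem.2] with u hu
  exact hy.2 u (Ioo_subset_Icc_self hu)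

/-- Reflecting time turns a solution into a solution of the reflected equation. -/
theorem comp_neg (hp : 0 < p) (hab : a ≤ b) (hmeas : Measurable h)
    (hbd : ∀ t ∈ Icc a b, |h t| ≤ M) (hf : IntervalIntegrable f volume a b)
    (hy : IsCaraSol p p' h f c a b y) :
    IsCaraSol p p' (fun t => -h (-t)) (fun t => -f (-t)) (-c) (-b) (-a) (fun t => y (-t)) := by
  refine ⟨hy.1.comp continuousOn_neg fun t ht => ⟨by linarith [ht.2], by linarith [ht.1]⟩,
    fun t ht => ?_⟩
  have ht' : -t ∈ Icc a b := ⟨by linarith [ht.2], by linarith [ht.1]⟩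
  have hb : b ∈ Icc a b := right_mem_Icc.2 hab
  have hI := intervalIntegrable_rhs hp hab hmeas hbd hf hy
  have hsub : ∀ x ∈ Icc a b, IntervalIntegrable
      (fun u => p' * ((c - h u) * (max (y u) 0) ^ (1 / p) - f u)) volume a x := fun x hx =>
    hI.mono_set (by rw [uIcc_of_le hab, uIcc_of_le hx.1]; exact Icc_subset_Icc_right hx.2)
  have hdiff := integral_interval_sub_left (hsub b hb) (hsub _ ht')
  have hrefl := integral_comp_neg (a := -b) (b := t)
    fun u => p' * ((c - h u) * (max (y u) 0) ^ (1 / p) - f u)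
  rw [neg_neg] at hrefl
  have hneg : (∫ u in -b..t, p' * ((-c - -h (-u)) * (max (y (-u)) 0) ^ (1 / p) - -f (-u))) =
      -∫ u in -b..t, p' * ((c - h (-u)) * (max (y (-u)) 0) ^ (1 / p) - f (-u)) := by
    rw [← intervalIntegral.integral_neg]
    congr 1
    ext u
    ring
  simp only [neg_neg]
  rw [hneg, hrefl, ← hdiff, hy.2 _ ht', hy.2 b hb]
  ring

variable {c₁ c₂ : ℝ} {y₁ y₂ : ℝ → ℝ}

/-- Where two positive solutions meet, the one with the smaller parameter was strictly larger
just before. -/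
theorem eventually_lt_of_eq (hp : 1 < p) (hp' : 0 < p') (hab : a ≤ b) (hmeas : Measurable h)
    (hbd : ∀ t ∈ Icc a b, |h t| ≤ M) (hf : IntervalIntegrable f volume a b) (hc : c₁ < c₂)
    (hy₁ : IsCaraSol p p' h f c₁ a b y₁) (hy₂ : IsCaraSol p p' h f c₂ a b y₂)
    {t : ℝ} (ht : t ∈ Ioo a b) (hpos : 0 < y₁ t) (heq : y₁ t = y₂ t) :
    ∀ᶠ u in 𝓝[<] t, y₂ u < y₁ u := by
  have hp0 : 0 < p := by linarith
  set Y₁ : ℝ → ℝ := fun u => (max (y₁ u) 0) ^ (1 / p) with hY₁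
  set Y₂ : ℝ → ℝ := fun u => (max (y₂ u) 0) ^ (1 / p) with hY₂
  have hcont : ∀ {y : ℝ → ℝ}, ContinuousOn y (Icc a b) →
      ContinuousAt (fun u => (max (y u) 0) ^ (1 / p)) t := fun hy =>
    ((hy.continuousAt (Icc_mem_nhds ht.1 ht.2)).sup continuousAt_const).rpow_const
      (Or.inr (by positivity))
  have hc₁ : ContinuousAt Y₁ t := hcont hy₁.1
  have hc₂ : ContinuousAt Y₂ t := hcont hy₂.1
  have hYt : 0 < Y₁ t := Real.rpow_pos_of_pos (lt_max_of_lt_left hpos) _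
  have hYeq : Y₁ t = Y₂ t := by simp only [hY₁, hY₂, heq]
  have hnear : ∀ᶠ u in 𝓝 t, (|c₂| + M) * |Y₁ u - Y₂ u| < (c₂ - c₁) * Y₁ u := by
    refine ContinuousAt.eventually_lt (f := fun u => (|c₂| + M) * |Y₁ u - Y₂ u|)
      (g := fun u => (c₂ - c₁) * Y₁ u) (by fun_prop) (by fun_prop) ?_
    simpa [hYeq] using mul_pos (sub_pos.2 hc) (hYeq ▸ hYt)
  obtain ⟨l, hl, hsub⟩ := (mem_nhdsLE_iff_exists_Ioc_subset' ht.1).1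
    (mem_nhdsWithin_of_mem_nhds (inter_mem hnear (Icc_mem_nhds ht.1 ht.2)))
  filter_upwards [Ioo_mem_nhdsLT hl] with u hu
  have hua : u ∈ Icc a b := (hsub ⟨hu.1, hu.2.le⟩).2
  have hta : t ∈ Icc a b := Ioo_subset_Icc_self ht
  have hsubI : ∀ {g : ℝ → ℝ}, IntervalIntegrable g volume a b → ∀ x ∈ Icc a b,
      IntervalIntegrable g volume a x := fun hg x hx =>
    hg.mono_set (by rw [uIcc_of_le hab, uIcc_of_le hx.1]; exact Icc_subset_Icc_right hx.2)
  have hI₁ := intervalIntegrable_rhs hp0 hab hmeas hbd hf hy₁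
  have hI₂ := intervalIntegrable_rhs hp0 hab hmeas hbd hf hy₂
  have e₁ := integral_interval_sub_left (hsubI hI₁ t hta) (hsubI hI₁ u hua)
  have e₂ := integral_interval_sub_left (hsubI hI₂ t hta) (hsubI hI₂ u hua)
  have hsubut : uIcc u t ⊆ uIcc a b := by
    rw [uIcc_of_le hab, uIcc_of_le hu.2.le]; exact Icc_subset_Icc hua.1 hta.2
  have hlt : 0 < ∫ v in u..t,
      (p' * ((c₂ - h v) * Y₂ v - f v) - p' * ((c₁ - h v) * Y₁ v - f v)) := by
    refine intervalIntegral_pos_of_pos_on ((hI₂.mono_set hsubut).sub (hI₁.mono_set hsubut)) ?_ hu.2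
    intro v hv
    obtain ⟨h1, hvI⟩ := hsub ⟨hu.1.trans hv.1, hv.2.le⟩
    have h1 : (|c₂| + M) * |Y₁ v - Y₂ v| < (c₂ - c₁) * Y₁ v := h1
    have h2 : |(c₂ - h v) * (Y₁ v - Y₂ v)| ≤ (|c₂| + M) * |Y₁ v - Y₂ v| := by
      rw [abs_mul]
      gcongr
      exact (abs_sub _ _).trans (by gcongr; exact hbd v hvI)
    have h3 := le_abs_self ((c₂ - h v) * (Y₁ v - Y₂ v))
    have : 0 < p' * ((c₂ - c₁) * Y₁ v - (c₂ - h v) * (Y₁ v - Y₂ v)) := mul_pos hp' (by linarith)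
    linarith
  rw [integral_sub (hI₂.mono_set hsubut) (hI₁.mono_set hsubut), ← e₁, ← e₂] at hlt
  have a1 := hy₁.2 t hta
  have a2 := hy₂.2 t hta
  have b1 := hy₁.2 u hua
  have b2 := hy₂.2 u hua
  linarith

/-- On an interval where both solutions are positive, ordered against their parameters, and
`f ≤ 0`, the difference of the transformed solutions `y ^ (1 - 1 / p)` does not increase. -/
theorem rpow_sub_rpow_le (hp : 1 < p) (hp' : p' = p / (p - 1)) (hab : a ≤ b)
    (hmeas : Measurable h) (hbd : ∀ t ∈ Icc a b, |h t| ≤ M) (hf : IntervalIntegrable f volume a b)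
    (hfneg : ∀ t ∈ Ioo a b, f t ≤ 0) (hc : c₁ ≤ c₂)
    (hy₁ : IsCaraSol p p' h f c₁ a b y₁) (hy₂ : IsCaraSol p p' h f c₂ a b y₂)
    {u t : ℝ} (hut : u ≤ t) (hu : a < u) (ht : t < b)
    (hpos : ∀ v ∈ Icc u t, 0 < y₂ v) (hle : ∀ v ∈ Icc u t, y₂ v ≤ y₁ v) :
    y₁ t ^ (1 - 1 / p) - y₂ t ^ (1 - 1 / p) ≤ y₁ u ^ (1 - 1 / p) - y₂ u ^ (1 - 1 / p) := by
  have hp0 : 0 < p := by linarith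
  have hsub : Icc u t ⊆ Icc a b := Icc_subset_Icc hu.le ht.le
  have hpr : (1 - 1 / p) * p' = 1 := by
    have : p - 1 ≠ 0 := by linarith
    rw [hp']; field_simp
  have hpos₁ : ∀ v ∈ Icc u t, 0 < y₁ v := fun v hv => (hpos v hv).trans_le (hle v hv)
  have hAC : ∀ {c : ℝ} {y : ℝ → ℝ}, IsCaraSol p p' h f c a b y → (∀ v ∈ Icc u t, 0 < y v) →
      AbsolutelyContinuousOnInterval (fun v => y v ^ (1 - 1 / p)) u t := by
    intro c y hy hypos
    have hyAC := (hy.absolutelyContinuousOnInterval hp0 hab hmeas hbd hf).mono (c := u) (d := t)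
      (by rwa [uIcc_of_le hab, uIcc_of_le hut])
    have hyc := hy.1.mono hsub
    obtain ⟨m, hm, hmin⟩ := isCompact_Icc.exists_isMinOn (nonempty_Icc.2 hut) hyc
    obtain ⟨x, hx, hmax⟩ := isCompact_Icc.exists_isMaxOn (nonempty_Icc.2 hut) hyc
    have hsm : ContDiffOn ℝ 1 (fun z : ℝ => z ^ (1 - 1 / p)) (Icc (y m) (y x)) := fun z hz =>
      (Real.contDiffAt_rpow_const_of_ne ((hypos m hm).trans_le hz.1).ne').contDiffWithinAt
    obtain ⟨K, hK⟩ := hsm.exists_lipschitzOnWith (by decide) (convex_Icc _ _) isCompact_Icc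
    refine hK.comp_absolutelyContinuousOnInterval hyAC ?_
    rw [uIcc_of_le hut]
    exact fun v hv => ⟨hmin hv, hmax hv⟩
  have hderiv : ∀ {c : ℝ} {y : ℝ → ℝ}, IsCaraSol p p' h f c a b y → (∀ v ∈ Icc u t, 0 < y v) →
      ∀ᵐ v, v ∈ Icc u t →
        HasDerivAt (fun v => y v ^ (1 - 1 / p)) ((c - h v) - f v * (y v) ^ (-(1 / p))) v := by
    intro c y hy hypos
    filter_upwards [hy.ae_hasDerivAt hp0 hab hmeas hbd hf] with v hv hvm
    have hyv := hypos v hvm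
    convert (hv ⟨hu.trans_le hvm.1, hvm.2.trans_lt ht⟩).rpow_const (p := 1 - 1 / p)
      (Or.inl hyv.ne') using 1
    rw [max_eq_left hyv.le, show 1 - 1 / p - 1 = -(1 / p) by ring]
    have hinv : y v ^ (1 / p) * y v ^ (-(1 / p)) = 1 := by
      rw [← Real.rpow_add hyv]; simp
    linear_combination (-(c - h v)) * hinv -
      ((c - h v) * y v ^ (1 / p) - f v) * y v ^ (-(1 / p)) * hpr
  refine ((hAC hy₁ hpos₁).fun_sub (hAC hy₂ hpos)).le_of_ae_deriv_nonpos hut ?_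
  filter_upwards [hderiv hy₁ hpos₁, hderiv hy₂ hpos] with v h₁ h₂ hv
  rw [((h₁ hv).fun_sub (h₂ hv)).deriv]
  have hmono : y₁ v ^ (-(1 / p)) ≤ y₂ v ^ (-(1 / p)) :=
    Real.rpow_le_rpow_of_nonpos (hpos v hv) (hle v hv) (by simp [hp0.le])
  have hfv := hfneg v ⟨hu.trans_le hv.1, hv.2.trans_lt ht⟩
  nlinarith

/-- Comparison of positive solutions vanishing at the left endpoint, for `f ≤ 0`. -/
theorem lt_of_param_lt (hp : 1 < p) (hp' : p' = p / (p - 1)) (hab : a ≤ b)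
    (hmeas : Measurable h) (hbd : ∀ t ∈ Icc a b, |h t| ≤ M) (hf : IntervalIntegrable f volume a b)
    (hfneg : ∀ t ∈ Ioo a b, f t ≤ 0) (hc : c₁ < c₂)
    (hy₁ : IsCaraSol p p' h f c₁ a b y₁) (hy₂ : IsCaraSol p p' h f c₂ a b y₂)
    (h₁a : y₁ a = 0) (h₂a : y₂ a = 0)
    (hpos₁ : ∀ t ∈ Ioo a b, 0 < y₁ t) (hpos₂ : ∀ t ∈ Ioo a b, 0 < y₂ t) :
    ∀ t ∈ Ioo a b, y₁ t < y₂ t := by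
  have hr : 0 < 1 - 1 / p := by
    rw [sub_pos, div_lt_one (by linarith)]; exact hp
  have hp'pos : 0 < p' := hp' ▸ div_pos (by linarith) (by linarith)
  have hle : ∀ t ∈ Ioo a b, y₁ t ≤ y₂ t := by
    intro t ht
    by_contra! hlt
    have hsub : Icc a t ⊆ Icc a b := Icc_subset_Icc_right ht.2.le
    have hclosed : IsCompact {u ∈ Icc a t | y₁ u ≤ y₂ u} :=
      isCompact_Icc.of_isClosed_subset
        (isClosed_Icc.isClosed_le (hy₁.1.mono hsub) (hy₂.1.mono hsub)) (sep_subset _ _)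
    obtain ⟨τ, ⟨hτ, hτle⟩, hτmax⟩ := hclosed.exists_isGreatest
      ⟨a, left_mem_Icc.2 ht.1.le, by rw [h₁a, h₂a]⟩
    have hτt : τ < t := lt_of_le_of_ne hτ.2 (by rintro rfl; exact hτle.not_gt hlt)
    have hgt : ∀ v ∈ Ioc τ t, y₂ v < y₁ v := fun v hv => by
      by_contra! hv'
      exact (hτmax ⟨⟨hτ.1.trans hv.1.le, hv.2⟩, hv'⟩).not_gt hv.1
    have hcont : ContinuousOn (fun u => y₁ u ^ (1 - 1 / p) - y₂ u ^ (1 - 1 / p)) (Icc a b) :=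
      (hy₁.1.rpow_const fun _ _ => Or.inr hr.le).sub (hy₂.1.rpow_const fun _ _ => Or.inr hr.le)
    have hlim : Tendsto (fun u => y₁ u ^ (1 - 1 / p) - y₂ u ^ (1 - 1 / p)) (𝓝[>] τ)
        (𝓝 (y₁ τ ^ (1 - 1 / p) - y₂ τ ^ (1 - 1 / p))) := by
      rw [← nhdsWithin_Ioo_eq_nhdsGT hτt]
      exact (hcont τ (hsub hτ)).mono
        ((Ioo_subset_Icc_self.trans (Icc_subset_Icc_left hτ.1)).trans hsub)
    have hmono : y₁ t ^ (1 - 1 / p) - y₂ t ^ (1 - 1 / p) ≤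
        y₁ τ ^ (1 - 1 / p) - y₂ τ ^ (1 - 1 / p) := by
      refine ge_of_tendsto hlim ?_
      filter_upwards [Ioo_mem_nhdsGT hτt] with u hu
      exact rpow_sub_rpow_le hp hp' hab hmeas hbd hf hfneg hc.le hy₁ hy₂ hu.2.le
        (hτ.1.trans_lt hu.1) ht.2
        (fun v hv => hpos₂ v ⟨(hτ.1.trans_lt hu.1).trans_le hv.1, hv.2.trans_lt ht.2⟩)
        (fun v hv => (hgt v ⟨hu.1.trans_le hv.1, hv.2⟩).le)
    have hτ0 : 0 ≤ y₁ τ := by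
      rcases hτ.1.eq_or_lt with rfl | hlt'
      · exact h₁a.ge
      · exact (hpos₁ τ ⟨hlt', hτt.trans ht.2⟩).le
    have := Real.rpow_le_rpow hτ0 hτle hr.le
    have := Real.rpow_lt_rpow (hpos₂ t ht).le hlt hr
    linarith
  intro t ht
  refine (hle t ht).lt_of_ne fun heq => ?_
  have hev := eventually_lt_of_eq hp hp'pos hab hmeas hbd hf hc hy₁ hy₂ ht (hpos₁ t ht) heq
  obtain ⟨u, hlt, hu⟩ := (hev.and (Ioo_mem_nhdsLT ht.1)).exists
  exact (hle u ⟨hu.1, hu.2.trans ht.2⟩).not_gt hlt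

end IsCaraSol

theorem stmt_6
    (p p' s : ℝ) (h f : ℝ → ℝ)
    (hp : 1 < p) (hp'def : p' = p / (p - 1))
    (hs : s ∈ Set.Ioo (0:ℝ) 1)
    (hmeas : Measurable h)
    (hbd : ∃ M : ℝ, ∀ t ∈ Set.Icc (0:ℝ) 1, |h t| ≤ M)
    (hfint : MeasureTheory.IntegrableOn f (Set.Ioo (0:ℝ) 1))
    (hf0 : f 0 = 0) (hfs : f s = 0) (hf1 : f 1 = 0)
    (hfneg : ∀ t ∈ Set.Ioo (0:ℝ) s, f t < 0)
    (hfpos : ∀ t ∈ Set.Ioo s (1:ℝ), 0 < f t)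
    (husc : UpperSemicontinuousOn f (Set.Ioo (0:ℝ) s))
    (hlsc : LowerSemicontinuousOn f (Set.Ioo s (1:ℝ)))
    (c₁ c₂ : ℝ) (hc : c₁ < c₂) :
    (∀ y₁ y₂, IsCaraSol p p' h f c₁ 0 s y₁ → IsCaraSol p p' h f c₂ 0 s y₂ →
      y₁ 0 = 0 → y₂ 0 = 0 →
      (∀ t ∈ Set.Ioo (0:ℝ) s, 0 < y₁ t) → (∀ t ∈ Set.Ioo (0:ℝ) s, 0 < y₂ t) →
      ∀ t ∈ Set.Ioo (0:ℝ) s, y₁ t < y₂ t) ∧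
    (∀ y₁ y₂, IsCaraSol p p' h f c₁ s 1 y₁ → IsCaraSol p p' h f c₂ s 1 y₂ →
      y₁ 1 = 0 → y₂ 1 = 0 →
      (∀ t ∈ Set.Ioo s (1:ℝ), 0 < y₁ t) → (∀ t ∈ Set.Ioo s (1:ℝ), 0 < y₂ t) →
      ∀ t ∈ Set.Ioo s (1:ℝ), y₂ t < y₁ t) := by
  obtain ⟨M, hM⟩ := hbd
  have hp0 : 0 < p := by linarith
  have hbd₀ : ∀ t ∈ Icc 0 s, |h t| ≤ M := fun t ht => hM t ⟨ht.1, ht.2.trans hs.2.le⟩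
  have hbd₁ : ∀ t ∈ Icc s 1, |h t| ≤ M := fun t ht => hM t ⟨hs.1.le.trans ht.1, ht.2⟩
  have hf₀ : IntervalIntegrable f volume 0 s :=
    (intervalIntegrable_iff_integrableOn_Ioo_of_le hs.1.le).2
      (hfint.mono_set (Ioo_subset_Ioo_right hs.2.le))
  have hf₁ : IntervalIntegrable f volume s 1 :=
    (intervalIntegrable_iff_integrableOn_Ioo_of_le hs.2.le).2
      (hfint.mono_set (Ioo_subset_Ioo_left hs.1.le))
  refine ⟨fun y₁ y₂ hy₁ hy₂ h₁ h₂ hpos₁ hpos₂ => hy₁.lt_of_param_lt hp hp'def hs.1.le hmeas hbd₀ hf₀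
    (fun t ht => (hfneg t ht).le) hc hy₂ h₁ h₂ hpos₁ hpos₂,
    fun y₁ y₂ hy₁ hy₂ h₁ h₂ hpos₁ hpos₂ t ht => ?_⟩
  have hmem : ∀ {t : ℝ}, t ∈ Ioo (-1) (-s) → -t ∈ Ioo s 1 := fun ht =>
    ⟨by linarith [ht.2], by linarith [ht.1]⟩
  have hcomp := (hy₂.comp_neg hp0 hs.2.le hmeas hbd₁ hf₁).lt_of_param_lt (M := M) hp hp'def
    (by linarith [hs.2]) (hmeas.comp measurable_neg).neg
    (fun t ht => by
      simpa using hbd₁ (-t) ⟨by linarith [ht.2], by linarith [ht.1]⟩)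
    (((IntervalIntegrable.iff_comp_neg (by finiteness)).1 hf₁).symm.neg)
    (fun t ht => by simpa using (hfpos _ (hmem ht)).le)
    (neg_lt_neg hc) (hy₁.comp_neg hp0 hs.2.le hmeas hbd₁ hf₁)
    (by simpa using h₂) (by simpa using h₁)
    (fun t ht => hpos₂ _ (hmem ht)) (fun t ht => hpos₁ _ (hmem ht))
    (-t) ⟨by linarith [ht.2], by linarith [ht.1]⟩
  simpa using hcomp
end
end
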